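/- Consider a composite system of K ≥ 1 qubits with Hilbert space ℂ^{2^K} indexed by functions f : {1,…,K} → {0,1}, and for each k let σ_k be the lowering operator on the k-th qubit, i.e., the matrix with entries σ_k(f, g) = 1 if f(k) = 0, g(k) = 1, and f(j) = g(j) for all j ≠ k, and 0 otherwise. Then for every Hermitian matrix H and every finite family of matrices (V_d) on this space, the Lindblad generator whose Lindblad operators consist of σ₁, …, σ_K together with the V_d has a unique steady state. -/

import Mathlib

open Matrix
open scoped ComplexOrder

/-- The Lindblad generator `𝓛(ρ) = -i[H,ρ] + Σ_d (V_d ρ V_d† - ½(V_d† V_d ρ + ρ V_d† V_d))`. -/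
noncomputable def lindblad {n : Type*} [Fintype n] [DecidableEq n] {ι : Type*} [Fintype ι]
    (H : Matrix n n ℂ) (V : ι → Matrix n n ℂ) (ρ : Matrix n n ℂ) : Matrix n n ℂ :=
  -Complex.I • (H * ρ - ρ * H) +
    ∑ d, (V d * ρ * (V d)ᴴ - (1 / 2 : ℂ) • ((V d)ᴴ * V d * ρ + ρ * ((V d)ᴴ * V d)))

/-- A density matrix: positive semidefinite with trace one. -/
def IsDensityMatrix {n : Type*} [Fintype n] (ρ : Matrix n n ℂ) : Prop :=
  ρ.PosSemidef ∧ ρ.trace = 1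

/-- A steady state of the Lindblad dynamics. -/
noncomputable def IsSteadyState {n : Type*} [Fintype n] [DecidableEq n] {ι : Type*} [Fintype ι]
    (H : Matrix n n ℂ) (V : ι → Matrix n n ℂ) (ρ : Matrix n n ℂ) : Prop :=
  IsDensityMatrix ρ ∧ lindblad H V ρ = 0

/-- The support of a matrix: its range as a linear map `ℂ^N → ℂ^N`. -/
noncomputable def matSupport {n : Type*} [Fintype n] (ρ : Matrix n n ℂ) :
    Submodule ℂ (n → ℂ) :=
  LinearMap.range ρ.mulVecLin

/-- An extremal steady state: it cannot be written as a nontrivial convex combination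
of two steady states other than itself. -/
noncomputable def IsExtremalSteadyState {n : Type*} [Fintype n] [DecidableEq n]
    {ι : Type*} [Fintype ι]
    (H : Matrix n n ℂ) (V : ι → Matrix n n ℂ) (ρ : Matrix n n ℂ) : Prop :=
  IsSteadyState H V ρ ∧
    ∀ (a : ℝ) (ρ₁ ρ₂ : Matrix n n ℂ), 0 < a → a < 1 →
      IsSteadyState H V ρ₁ → IsSteadyState H V ρ₂ →
      ρ = a • ρ₁ + (1 - a) • ρ₂ → ρ₁ = ρ ∧ ρ₂ = ρ

open scoped Classical in
/-- The lowering operator on the `k`-th qubit of a `K`-qubit system. -/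
noncomputable def loweringOp (K : ℕ) (k : Fin K) :
    Matrix (Fin K → Fin 2) (Fin K → Fin 2) ℂ :=
  Matrix.of fun f g : Fin K → Fin 2 =>
    if f k = 0 ∧ g k = 1 ∧ ∀ j : Fin K, j ≠ k → f j = g j then 1 else 0

/-- A stationary signed measure `d` of a Markov jump process with rates `w i j` from `j` to `i`
has no flow out of the set where it is positive. -/
lemma stationary_rate_eq_zero {n : Type*} [Fintype n] (w : n → n → ℝ) (d : n → ℝ)
    (hw : ∀ i j, 0 ≤ w i j) (hd : ∀ i, ∑ j, (w i j * d j - w j i * d i) = 0)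
    {i j : n} (hi : ¬ 0 < d i) (hj : 0 < d j) : w i j = 0 := by
  classical
  let P : Finset n := Finset.univ.filter fun k => 0 < d k
  let f : n → n → ℝ := fun k l => w k l * d l - w l k * d k
  have hPP : ∑ k ∈ P, ∑ l ∈ P, f k l = 0 := by
    have h : ∑ k ∈ P, ∑ l ∈ P, f k l = -∑ k ∈ P, ∑ l ∈ P, f k l := by
      conv_lhs => rw [Finset.sum_comm]
      simp only [← Finset.sum_neg_distrib]
      refine Finset.sum_congr rfl fun k _ => Finset.sum_congr rfl fun l _ => ?_
      simp only [f]; ring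
    linarith
  have hPQ : ∑ k ∈ P, ∑ l ∈ Pᶜ, f k l = 0 := by
    have h : ∑ k ∈ P, (∑ l ∈ P, f k l + ∑ l ∈ Pᶜ, f k l) = 0 :=
      Finset.sum_eq_zero fun k _ => by rw [Finset.sum_add_sum_compl]; exact hd k
    rwa [Finset.sum_add_distrib, hPP, zero_add] at h
  have hf : ∀ k ∈ P, ∀ l ∈ Pᶜ, f k l ≤ 0 := by
    intro k hk l hl
    have hk' : 0 < d k := by simpa [P] using hk
    have hl' : d l ≤ 0 := by simpa [P] using hl
    have h1 := mul_nonpos_of_nonneg_of_nonpos (hw k l) hl'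
    have h2 := mul_nonneg (hw l k) hk'.le
    simp only [f]; linarith
  have hjP : j ∈ P := by simpa [P] using hj
  have hiP : i ∈ Pᶜ := by simpa [P] using hi
  have hji : f j i = 0 :=
    (Finset.sum_eq_zero_iff_of_nonpos (hf j hjP)).1
      ((Finset.sum_eq_zero_iff_of_nonpos fun k hk => Finset.sum_nonpos (hf k hk)).1 hPQ j hjP) i hiP
  have h1 := mul_nonpos_of_nonneg_of_nonpos (hw j i) (not_lt.1 hi)
  have h2 := mul_nonneg (hw i j) hj.le
  have h3 : w i j * d j = 0 := by simp only [f] at hji; linarith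
  exact (mul_eq_zero.1 h3).resolve_right hj.ne'

section Lindblad

variable {n : Type*} [Fintype n] [DecidableEq n] {ι : Type*} [Fintype ι]

lemma map_lindblad (φ : Matrix n n ℂ ≃⋆ₐ[ℂ] Matrix n n ℂ) (H : Matrix n n ℂ)
    (V : ι → Matrix n n ℂ) (ρ : Matrix n n ℂ) :
    φ (lindblad H V ρ) = lindblad (φ H) (fun d => φ (V d)) (φ ρ) := by
  simp only [lindblad, ← star_eq_conjTranspose, map_add, map_sub, map_sum, map_mul, map_smul,
    map_star]

lemma lindblad_add (H : Matrix n n ℂ) (V : ι → Matrix n n ℂ) (ρ σ : Matrix n n ℂ) :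
    lindblad H V (ρ + σ) = lindblad H V ρ + lindblad H V σ := by
  simp only [lindblad, mul_add, add_mul, smul_add, smul_sub, Finset.sum_add_distrib,
    Finset.sum_sub_distrib]
  abel

lemma lindblad_smul (H : Matrix n n ℂ) (V : ι → Matrix n n ℂ) (c : ℂ) (ρ : Matrix n n ℂ) :
    lindblad H V (c • ρ) = c • lindblad H V ρ := by
  simp only [lindblad, mul_smul_comm, smul_mul_assoc, smul_add, smul_sub, Finset.smul_sum,
    smul_comm c]

/-- The Lindblad generator as a linear map. -/
noncomputable def lindbladLin (H : Matrix n n ℂ) (V : ι → Matrix n n ℂ) :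
    Matrix n n ℂ →ₗ[ℂ] Matrix n n ℂ where
  toFun := lindblad H V
  map_add' := lindblad_add H V
  map_smul' := lindblad_smul H V

lemma lindblad_sub (H : Matrix n n ℂ) (V : ι → Matrix n n ℂ) (ρ σ : Matrix n n ℂ) :
    lindblad H V (ρ - σ) = lindblad H V ρ - lindblad H V σ :=
  map_sub (lindbladLin H V) ρ σ

lemma trace_lindblad (H : Matrix n n ℂ) (V : ι → Matrix n n ℂ) (ρ : Matrix n n ℂ) :
    (lindblad H V ρ).trace = 0 := by
  simp only [lindblad, trace_add, trace_sub, trace_smul, trace_sum]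
  rw [trace_mul_comm H ρ, sub_self, smul_zero, zero_add]
  refine Finset.sum_eq_zero fun d _ => ?_
  rw [trace_mul_comm ρ, trace_mul_comm (V d * ρ), ← mul_assoc, ← two_smul ℂ, smul_smul]
  norm_num

lemma lindblad_conjTranspose {H : Matrix n n ℂ} (hH : H.IsHermitian)
    (V : ι → Matrix n n ℂ) (ρ : Matrix n n ℂ) :
    lindblad H V ρᴴ = (lindblad H V ρ)ᴴ := by
  simp only [lindblad, conjTranspose_add, conjTranspose_sub, conjTranspose_smul,
    conjTranspose_sum, conjTranspose_mul, conjTranspose_conjTranspose, hH.eq, mul_assoc]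
  congr 1
  · simp only [star_neg, Complex.star_def, Complex.conj_I, neg_neg, neg_smul, smul_sub]
    abel
  · refine Finset.sum_congr rfl fun d _ => ?_
    simp [add_comm]

/-- On diagonal matrices, the diagonal of the Lindblad generator is a classical master
equation. -/
lemma lindblad_diagonal_apply_self (H : Matrix n n ℂ) (V : ι → Matrix n n ℂ) (d : n → ℝ) (i : n) :
    lindblad H V (diagonal fun k => (d k : ℂ)) i i =
      ((∑ j, ((∑ v, Complex.normSq (V v i j)) * d j -
        (∑ v, Complex.normSq (V v j i)) * d i) : ℝ) : ℂ) := by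
  have h1 : ∀ v, (V v * diagonal (fun k => (d k : ℂ)) * (V v)ᴴ) i i =
      ∑ j, (Complex.normSq (V v i j) : ℂ) * d j := by
    intro v
    rw [mul_apply]
    refine Finset.sum_congr rfl fun j _ => ?_
    rw [mul_diagonal, conjTranspose_apply, ← Complex.mul_conj, Complex.star_def]
    ring
  have h2 : ∀ v, ((V v)ᴴ * V v) i i = ∑ j, (Complex.normSq (V v j i) : ℂ) := by
    intro v
    rw [mul_apply]
    refine Finset.sum_congr rfl fun j _ => ?_
    rw [conjTranspose_apply, ← Complex.mul_conj, Complex.star_def, mul_comm]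
  simp only [lindblad, Matrix.add_apply, Matrix.sub_apply, Matrix.smul_apply, Matrix.sum_apply,
    h1, mul_diagonal, diagonal_mul, h2]
  push_cast
  simp only [Finset.sum_mul, Finset.sum_sub_distrib, smul_eq_mul]
  rw [mul_comm (H i i), sub_self, mul_zero, zero_add, Finset.sum_comm]
  congr 1
  rw [Finset.sum_comm]
  refine Finset.sum_congr rfl fun v _ => ?_
  rw [← Finset.sum_mul]
  ring

lemma apply_eq_zero_of_lindblad_diagonal_eq_zero {H : Matrix n n ℂ} {V : ι → Matrix n n ℂ}
    {d : n → ℝ} (h : lindblad H V (diagonal fun k => (d k : ℂ)) = 0) (v : ι) {i j : n}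
    (hi : ¬ 0 < d i) (hj : 0 < d j) : V v i j = 0 := by
  have hw := stationary_rate_eq_zero (fun i j => ∑ v, Complex.normSq (V v i j)) d
    (fun i j => Finset.sum_nonneg fun v _ => Complex.normSq_nonneg _)
    (fun k => by
      have hk := lindblad_diagonal_apply_self H V d k
      rw [h, Matrix.zero_apply] at hk
      exact_mod_cast hk.symm) hi hj
  rw [Finset.sum_eq_zero_iff_of_nonneg fun v _ => Complex.normSq_nonneg _] at hw
  exact Complex.normSq_eq_zero.1 (hw v (Finset.mem_univ v))

/-- If a nonzero vector `e` lies in every nonzero subspace invariant under the Lindblad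
operators, then `e`, written in an eigenbasis of a Hermitian stationary matrix, is
supported on the positive eigenvalues, provided that there are any. -/
lemma star_eigenvectorUnitary_mulVec_eq_zero {H : Matrix n n ℂ} {V : ι → Matrix n n ℂ}
    {e : n → ℂ}
    (hV : ∀ S : Submodule ℂ (n → ℂ), S ≠ ⊥ → (∀ v, ∀ x ∈ S, V v *ᵥ x ∈ S) → e ∈ S)
    (U : unitary (Matrix n n ℂ)) (d : n → ℝ)
    (h : lindblad H V (Unitary.conjStarAlgAut ℂ _ U (diagonal fun k => (d k : ℂ))) = 0)
    {j : n} (hj : 0 < d j) {i : n} (hi : ¬ 0 < d i) :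
    (star (U : Matrix n n ℂ) *ᵥ e) i = 0 := by
  have hUU : star (U : Matrix n n ℂ) * U = 1 := Unitary.coe_star_mul_self U
  have hUU' : (U : Matrix n n ℂ) * star (U : Matrix n n ℂ) = 1 := Unitary.coe_mul_star_self U
  let φ := Unitary.conjStarAlgAut ℂ (Matrix n n ℂ) U
  have hdiag : lindblad (φ.symm H) (fun v => φ.symm (V v)) (diagonal fun k => (d k : ℂ)) = 0 := by
    have h' := map_lindblad φ.symm H V (φ (diagonal fun k => (d k : ℂ)))
    rw [h, map_zero, StarAlgEquiv.symm_apply_apply] at h'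
    exact h'.symm
  let S : Submodule ℂ (n → ℂ) :=
    { carrier := {x | ∀ k, ¬ 0 < d k → (star (U : Matrix n n ℂ) *ᵥ x) k = 0}
      add_mem' := fun {x y} hx hy k hk => by
        rw [mulVec_add, Pi.add_apply, hx k hk, hy k hk, add_zero]
      zero_mem' := fun k _ => by simp
      smul_mem' := fun c x hx k hk => by rw [mulVec_smul, Pi.smul_apply, hx k hk, smul_zero] }
  refine hV S ?_ ?_ i hi
  · have hmem : (U : Matrix n n ℂ) *ᵥ Pi.single j 1 ∈ S := by
      intro k hk
      rw [mulVec_mulVec, hUU, one_mulVec, Pi.single_eq_of_ne]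
      rintro rfl
      exact hk hj
    intro hS
    rw [hS, Submodule.mem_bot] at hmem
    have h0 := congrArg (fun x => (star (U : Matrix n n ℂ) *ᵥ x) j) hmem
    rw [mulVec_mulVec, hUU, one_mulVec, mulVec_zero, Pi.single_eq_same] at h0
    exact one_ne_zero h0
  · intro v x hx k hk
    have hconj : star (U : Matrix n n ℂ) *ᵥ (V v *ᵥ x) =
        φ.symm (V v) *ᵥ (star (U : Matrix n n ℂ) *ᵥ x) := by
      rw [Unitary.conjStarAlgAut_symm_apply, mulVec_mulVec, mulVec_mulVec, mul_assoc, hUU',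
        mul_one]
    rw [hconj, mulVec_eq_sum, Finset.sum_apply]
    refine Finset.sum_eq_zero fun l _ => ?_
    by_cases hl : 0 < d l
    · have hkl := apply_eq_zero_of_lindblad_diagonal_eq_zero hdiag v hk hl
      simp [hkl]
    · simp [hx l hl]

lemma posSemidef_or_neg_posSemidef_of_lindblad_eq_zero {H : Matrix n n ℂ}
    {V : ι → Matrix n n ℂ} {e : n → ℂ} (he : e ≠ 0)
    (hV : ∀ S : Submodule ℂ (n → ℂ), S ≠ ⊥ → (∀ v, ∀ x ∈ S, V v *ᵥ x ∈ S) → e ∈ S)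
    {X : Matrix n n ℂ} (hX : X.IsHermitian) (h : lindblad H V X = 0) :
    X.PosSemidef ∨ (-X).PosSemidef := by
  let U := hX.eigenvectorUnitary
  let d := hX.eigenvalues
  have hXd : X = Unitary.conjStarAlgAut ℂ _ U (diagonal fun k => (d k : ℂ)) := hX.spectral_theorem
  have hnegXd : -X = Unitary.conjStarAlgAut ℂ _ U (diagonal fun k => ((-d k : ℝ) : ℂ)) := by
    rw [hXd, ← map_neg, diagonal_neg]
    simp
  have hneg : lindblad H V (-X) = 0 := by
    rw [← neg_one_smul ℂ X, lindblad_smul, h, smul_zero]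
  have key : (∀ k, ¬ 0 < d k) ∨ (∀ k, ¬ 0 < -d k) := by
    by_contra! hcon
    obtain ⟨⟨j, hj⟩, ⟨l, hl⟩⟩ := hcon
    have hzero : star (U : Matrix n n ℂ) *ᵥ e = 0 := by
      funext i
      by_cases hi : 0 < d i
      · exact star_eigenvectorUnitary_mulVec_eq_zero hV U (fun k => -d k) (hnegXd ▸ hneg) hl
          (by linarith)
      · exact star_eigenvectorUnitary_mulVec_eq_zero hV U d (hXd ▸ h) hj hi
    apply he
    rw [← one_mulVec e, ← Unitary.coe_mul_star_self U, ← mulVec_mulVec, Unitary.coe_star, hzero,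
      mulVec_zero]
  have hpsd : ∀ c : n → ℝ, (∀ k, 0 ≤ c k) →
      (Unitary.conjStarAlgAut ℂ _ U (diagonal fun k => (c k : ℂ))).PosSemidef := fun c hc =>
    PosSemidef.mul_mul_conjTranspose_same
      (posSemidef_diagonal_iff.2 fun k => by exact_mod_cast hc k) (U : Matrix n n ℂ)
  rcases key with hk | hk
  · right
    rw [hnegXd]
    exact hpsd _ fun k => by linarith [hk k]
  · left
    rw [hXd]
    exact hpsd _ fun k => by linarith [hk k]

lemma exists_isHermitian_lindblad_eq_zero [Nonempty n] {H : Matrix n n ℂ} (hH : H.IsHermitian)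
    (V : ι → Matrix n n ℂ) :
    ∃ X : Matrix n n ℂ, X.IsHermitian ∧ X ≠ 0 ∧ lindblad H V X = 0 := by
  have hsurj : ¬ Function.Surjective (lindbladLin H V) := by
    intro hs
    obtain ⟨Y, hY⟩ := hs 1
    have htr := trace_lindblad H V Y
    rw [show lindblad H V Y = 1 from hY, trace_one] at htr
    exact Fintype.card_ne_zero (by exact_mod_cast htr)
  rw [← LinearMap.injective_iff_surjective, injective_iff_map_eq_zero] at hsurj
  push Not at hsurj
  obtain ⟨Y, hY, hY0⟩ := hsurj
  replace hY : lindblad H V Y = 0 := hY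
  have hYs : lindblad H V Yᴴ = 0 := by rw [lindblad_conjTranspose hH, hY, conjTranspose_zero]
  by_cases hsum : Y + Yᴴ = 0
  · refine ⟨Complex.I • Y, ?_, smul_ne_zero Complex.I_ne_zero hY0, ?_⟩
    · rw [IsHermitian, conjTranspose_smul, eq_neg_of_add_eq_zero_right hsum]
      simp
    · rw [lindblad_smul, hY, smul_zero]
  · exact ⟨Y + Yᴴ, isHermitian_add_transpose_self Y, hsum, by
      rw [lindblad_add, hY, hYs, add_zero]⟩

theorem existsUnique_isSteadyState {H : Matrix n n ℂ} (hH : H.IsHermitian)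
    {V : ι → Matrix n n ℂ} {e : n → ℂ} (he : e ≠ 0)
    (hV : ∀ S : Submodule ℂ (n → ℂ), S ≠ ⊥ → (∀ v, ∀ x ∈ S, V v *ᵥ x ∈ S) → e ∈ S) :
    ∃! ρ : Matrix n n ℂ, IsSteadyState H V ρ := by
  have : Nonempty n := by
    obtain ⟨i, -⟩ := Function.ne_iff.1 he
    exact ⟨i⟩
  refine existsUnique_of_exists_of_unique ?_ ?_
  · obtain ⟨Y, hYpsd, hY0, hY⟩ :
        ∃ Y : Matrix n n ℂ, Y.PosSemidef ∧ Y ≠ 0 ∧ lindblad H V Y = 0 := by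
      obtain ⟨X, hXh, hX0, hX⟩ := exists_isHermitian_lindblad_eq_zero hH V
      rcases posSemidef_or_neg_posSemidef_of_lindblad_eq_zero he hV hXh hX with h | h
      · exact ⟨X, h, hX0, hX⟩
      · exact ⟨-X, h, neg_ne_zero.2 hX0, by
          rw [← neg_one_smul ℂ X, lindblad_smul, hX, smul_zero]⟩
    have htr : Y.trace ≠ 0 := mt hYpsd.trace_eq_zero_iff.1 hY0
    refine ⟨Y.trace⁻¹ • Y, ⟨hYpsd.smul (inv_nonneg.2 hYpsd.trace_nonneg), ?_⟩, ?_⟩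
    · rw [trace_smul, smul_eq_mul, inv_mul_cancel₀ htr]
    · rw [lindblad_smul, hY, smul_zero]
  · rintro ρ σ ⟨⟨hρ, hρ1⟩, hρ0⟩ ⟨⟨hσ, hσ1⟩, hσ0⟩
    have hL : lindblad H V (ρ - σ) = 0 := by rw [lindblad_sub, hρ0, hσ0, sub_zero]
    have htr : (ρ - σ).trace = 0 := by rw [trace_sub, hρ1, hσ1, sub_self]
    rcases posSemidef_or_neg_posSemidef_of_lindblad_eq_zero he hV (hρ.1.sub hσ.1) hL with h | h
    · exact sub_eq_zero.1 (h.trace_eq_zero_iff.1 htr)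
    · exact sub_eq_zero.1 (neg_eq_zero.1 (h.trace_eq_zero_iff.1 (by rw [trace_neg, htr, neg_zero])))

end Lindblad

lemma loweringOp_mulVec_apply {K : ℕ} (k : Fin K) (x : (Fin K → Fin 2) → ℂ) (f : Fin K → Fin 2) :
    (loweringOp K k *ᵥ x) f = if f k = 0 then x (Function.update f k 1) else 0 := by
  have hiff : ∀ g : Fin K → Fin 2, (f k = 0 ∧ g k = 1 ∧ ∀ j, j ≠ k → f j = g j) ↔
      (f k = 0 ∧ g = Function.update f k 1) := by
    intro g
    rw [Function.eq_update_iff]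
    simp only [ne_eq, eq_comm]
  simp only [mulVec, dotProduct, loweringOp, of_apply, hiff]
  by_cases hf : f k = 0 <;> simp [hf]

/-- A subspace invariant under all lowering operators that contains a nonzero vector contains the
ground state. -/
lemma single_zero_mem_of_loweringOp_invariant {K : ℕ} (S : Submodule ℂ ((Fin K → Fin 2) → ℂ))
    (hS : ∀ k, ∀ x ∈ S, loweringOp K k *ᵥ x ∈ S) (m : ℕ) :
    ∀ x ∈ S, ∀ f : Fin K → Fin 2, x f ≠ 0 → ∑ k, (f k : ℕ) = m →
      (∀ g, x g ≠ 0 → ∑ k, (g k : ℕ) ≤ m) →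
      (Pi.single 0 1 : (Fin K → Fin 2) → ℂ) ∈ S := by
  induction m with
  | zero =>
    intro x hx f hf hfm hmax
    have hzero : ∀ g : Fin K → Fin 2, ∑ k, (g k : ℕ) = 0 → g = 0 := by
      intro g hg
      funext k
      exact Fin.ext ((Finset.sum_eq_zero_iff.1 hg) k (Finset.mem_univ k))
    have hf0 := hzero f hfm
    subst hf0
    have hx0 : (Pi.single 0 1 : (Fin K → Fin 2) → ℂ) = (x 0)⁻¹ • x := by
      funext g
      by_cases hg : g = 0
      · subst hg
        simp [hf]
      · have hxg : x g = 0 := by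
          by_contra hne
          exact hg (hzero g (Nat.le_zero.1 (hmax g hne)))
        simp [hg, hxg]
    rw [hx0]
    exact S.smul_mem _ hx
  | succ m ih =>
    intro x hx f hf hfm hmax
    have hupdate : ∀ (g : Fin K → Fin 2) (k : Fin K), g k = 0 →
        ∑ l, (Function.update g k 1 l : ℕ) = ∑ l, (g l : ℕ) + 1 := by
      intro g k hg
      rw [← Finset.add_sum_erase _ _ (Finset.mem_univ k),
        ← Finset.add_sum_erase _ (fun l => (g l : ℕ)) (Finset.mem_univ k)]
      have herase : ∑ l ∈ Finset.univ.erase k, (Function.update g k 1 l : ℕ) =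
          ∑ l ∈ Finset.univ.erase k, (g l : ℕ) :=
        Finset.sum_congr rfl fun l hl => by
          rw [Function.update_of_ne (Finset.ne_of_mem_erase hl)]
      rw [herase]
      simp [hg, add_comm]
    obtain ⟨k, -, hk⟩ := Finset.exists_ne_zero_of_sum_ne_zero (hfm.trans_ne m.succ_ne_zero)
    have hk1 : f k = 1 := by
      have := (f k).isLt
      apply Fin.ext
      simp only [Fin.val_one]
      omega
    have hff : Function.update (Function.update f k 0) k 1 = f := by
      rw [Function.update_idem, ← hk1, Function.update_eq_self]
    refine ih _ (hS k x hx) (Function.update f k 0) ?_ ?_ ?_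
    · rw [loweringOp_mulVec_apply, if_pos (Function.update_self ..), hff]
      exact hf
    · have h := hupdate (Function.update f k 0) k (Function.update_self ..)
      rw [hff, hfm] at h
      omega
    · intro g hg
      rw [loweringOp_mulVec_apply] at hg
      split_ifs at hg with hgk
      · have h := hmax _ hg
        rw [hupdate g k hgk] at h
        omega
      · exact absurd rfl hg

/-- A composite system of `K` qubits whose Lindblad operators include the lowering
operator of every qubit has a unique steady state. -/
theorem unique_steady_state_composite_lowering (K : ℕ) (hK : 1 ≤ K)
    (H : Matrix (Fin K → Fin 2) (Fin K → Fin 2) ℂ) (hH : H.IsHermitian)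
    {ι : Type*} [Fintype ι] (V : ι → Matrix (Fin K → Fin 2) (Fin K → Fin 2) ℂ) :
    ∃! ρ : Matrix (Fin K → Fin 2) (Fin K → Fin 2) ℂ,
      IsSteadyState H (Sum.elim (loweringOp K) V) ρ := by
  refine existsUnique_isSteadyState hH (e := Pi.single 0 1) (by simp) fun S hS hinv => ?_
  obtain ⟨x, hx, hx0⟩ := S.exists_mem_ne_zero_of_ne_bot hS
  obtain ⟨f₀, hf₀⟩ := Function.ne_iff.1 hx0
  obtain ⟨f, hf, hmax⟩ := Finset.exists_max_image
    (Finset.univ.filter fun f : Fin K → Fin 2 => x f ≠ 0) (fun f => ∑ k, (f k : ℕ))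
    ⟨f₀, by simpa using hf₀⟩
  exact single_zero_mem_of_loweringOp_invariant S (fun k => hinv (Sum.inl k)) _ x hx f
    (by simpa using hf) rfl fun g hg => hmax g (by simpa using hg)
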